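/- Assume Ω satisfies S-propagation, the observed values T̂_α are nonzero for all α ∈ Ω, and there exists a rank-one tensor T with T_α = T̂_α for all α ∈ Ω. Then there exists t ∈ (0,1) such that for every ϑ ∈ (0,t), the weighted relaxation (SDP-Eʷ) with the level-based weight vector w(ϑ) is tight, i.e. its unique optimal solution is the matrix 𝐗̄ built from the unique rank-one completion. -/

import Mathlib

namespace RankOneTC

open scoped BigOperators
open MeasureTheory

/-- The index set `⟦N⟧ = [n 0] × ⋯ × [n (d-1)]`. -/
abbrev Idx {d : ℕ} (n : Fin d → ℕ) : Type := ∀ i : Fin d, Fin (n i)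

/-- A tensor is rank one if it is an outer product of `d` vectors. -/
def IsRankOne {d : ℕ} {n : Fin d → ℕ} (T : Idx n → ℝ) : Prop :=
  ∃ u : ∀ i : Fin d, Fin (n i) → ℝ, ∀ α : Idx n, T α = ∏ i : Fin d, u i (α i)

/-- `Ω` satisfies unique recovery: for any nonzero observed values, the rank-one
completion problem is infeasible or has exactly one solution. -/
def UniqueRecovery {d : ℕ} {n : Fin d → ℕ} (Ω : Set (Idx n)) : Prop :=
  ∀ That : Idx n → ℝ, (∀ α ∈ Ω, That α ≠ 0) →
    {T : Idx n → ℝ | IsRankOne T ∧ ∀ α ∈ Ω, T α = That α}.Subsingleton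

/-- The 𝔽₂ vector `v_α`, the concatenation of indicator vectors of the coordinates. -/
def vF2 {d : ℕ} {n : Fin d → ℕ} (α : Idx n) : (Σ i : Fin d, Fin (n i)) → ZMod 2 :=
  fun s => if α s.1 = s.2 then 1 else 0

/-- A generalized square: four distinct tuples whose `v`-vectors sum to zero over 𝔽₂. -/
def IsGenSquare {d : ℕ} {n : Fin d → ℕ} (α₁ α₂ α₃ α₄ : Idx n) : Prop :=
  [α₁, α₂, α₃, α₄].Nodup ∧ vF2 α₁ + vF2 α₂ + vF2 α₃ + vF2 α₄ = 0

/-- A square `{α₁,α₂;α₃,α₄}`: four distinct tuples with coordinatewise equal max and min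
of the two opposite pairs. -/
def IsSquare {d : ℕ} {n : Fin d → ℕ} (α₁ α₂ α₃ α₄ : Idx n) : Prop :=
  [α₁, α₂, α₃, α₄].Nodup ∧
    ∀ k : Fin d, max (α₁ k) (α₂ k) = max (α₃ k) (α₄ k) ∧
      min (α₁ k) (α₂ k) = min (α₃ k) (α₄ k)

/-- The GS-propagated set `𝒫_GS(Ω)` as an inductive predicate. -/
inductive PGS {d : ℕ} {n : Fin d → ℕ} (Ω : Set (Idx n)) : Idx n → Prop
  | base {α : Idx n} : α ∈ Ω → PGS Ω α
  | prop {α₁ α₂ α₃ β : Idx n} : IsGenSquare α₁ α₂ α₃ β →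
      PGS Ω α₁ → PGS Ω α₂ → PGS Ω α₃ → PGS Ω β

def GSPropagation {d : ℕ} {n : Fin d → ℕ} (Ω : Set (Idx n)) : Prop :=
  ∀ β : Idx n, PGS Ω β

/-- The S-propagated set `𝒫_S(Ω)` as an inductive predicate. -/
inductive PS {d : ℕ} {n : Fin d → ℕ} (Ω : Set (Idx n)) : Idx n → Prop
  | base {α : Idx n} : α ∈ Ω → PS Ω α
  | prop {α₁ α₂ α₃ β : Idx n} : IsSquare α₁ α₂ α₃ β →
      PS Ω α₁ → PS Ω α₂ → PS Ω α₃ → PS Ω β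

def SPropagation {d : ℕ} {n : Fin d → ℕ} (Ω : Set (Idx n)) : Prop :=
  ∀ β : Idx n, PS Ω β

/-- The SR-propagated set `𝒫_SR(Ω)` as an inductive predicate. -/
inductive PSR {d : ℕ} {n : Fin d → ℕ} (Ω : Set (Idx n)) : Idx n → Prop
  | base {α : Idx n} : α ∈ Ω → PSR Ω α
  | prop {α₁ β α₂ γ : Idx n} : IsSquare α₁ β α₂ γ →
      α₁ ∈ Ω → α₂ ∈ Ω → PSR Ω β → PSR Ω γ

def SRPropagation {d : ℕ} {n : Fin d → ℕ} (Ω : Set (Idx n)) : Prop :=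
  ∀ β : Idx n, PSR Ω β

/-- A sequence is strongly connected if each later element agrees with some earlier
element in exactly `d - 1` coordinates. -/
def StronglyConnected {d : ℕ} {n : Fin d → ℕ} {p : ℕ} (α : Fin p → Idx n) : Prop :=
  ∀ k : Fin p, 0 < (k : ℕ) → ∃ i : Fin p, i < k ∧
    (Finset.univ.filter fun j : Fin d => α k j = α i j).card = d - 1

/-- A-propagation: a strongly connected sequence of elements of `Ω` covering all
coordinates. -/
def APropagation {d : ℕ} {n : Fin d → ℕ} (Ω : Set (Idx n)) : Prop :=
  ∃ (p : ℕ) (α : Fin p → Idx n), (∀ k, α k ∈ Ω) ∧ StronglyConnected α ∧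
    ∀ (i : Fin d) (j : Fin (n i)), ∃ k : Fin p, α k i = j

/-- The 𝔽₂ matrix `V_Ω` whose rows are the vectors `v_α`, `α ∈ Ω`. -/
def maskMatrix {d : ℕ} {n : Fin d → ℕ} (Ω : Finset (Idx n)) :
    Matrix {α : Idx n // α ∈ Ω} (Σ i : Fin d, Fin (n i)) (ZMod 2) :=
  Matrix.of fun α s => vF2 α.1 s

/-! ### SDP formulations -/

/-- The bordered matrix `𝐗 = [[1, xᵀ],[x, X]]`, indexed by `Option (Idx n)` where
`none` is the extra index. -/
def border {d : ℕ} {n : Fin d → ℕ} (x : Idx n → ℝ) (X : Matrix (Idx n) (Idx n) ℝ) :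
    Matrix (Option (Idx n)) (Option (Idx n)) ℝ :=
  Matrix.of fun a b =>
    match a, b with
    | Option.none, Option.none => (1 : ℝ)
    | Option.none, Option.some β => x β
    | Option.some α, Option.none => x α
    | Option.some α, Option.some β => X α β

/-- Feasibility for the exact SDP relaxation (SDP-E). -/
structure SDPEFeasible {d : ℕ} {n : Fin d → ℕ} (Ω : Set (Idx n)) (That : Idx n → ℝ)
    (x : Idx n → ℝ) (X : Matrix (Idx n) (Idx n) ℝ) : Prop where
  isSymm : X.IsSymm
  obs : ∀ α ∈ Ω, x α = That α
  obsDiag : ∀ α ∈ Ω, X α α = That α ^ 2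
  squares : ∀ α₁ α₂ α₃ α₄ : Idx n, IsSquare α₁ α₂ α₃ α₄ → X α₁ α₂ = X α₃ α₄
  psd : (border x X).PosSemidef

/-- Tightness of (SDP-E): the matrix `𝐗̄` built from the completion `T` is feasible and
is the unique minimizer of the trace objective. -/
def SDPETight {d : ℕ} {n : Fin d → ℕ} (Ω : Set (Idx n)) (That T : Idx n → ℝ) : Prop :=
  SDPEFeasible Ω That T (Matrix.vecMulVec T T) ∧
  ∀ x X, SDPEFeasible Ω That x X →
    Matrix.trace (Matrix.vecMulVec T T) ≤ Matrix.trace X ∧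
    (Matrix.trace X = Matrix.trace (Matrix.vecMulVec T T) →
      x = T ∧ X = Matrix.vecMulVec T T)

/-- Tightness of the weighted relaxation (SDP-Eʷ) with weights `w`. -/
def SDPEwTight {d : ℕ} {n : Fin d → ℕ} (Ω : Set (Idx n)) (w : Idx n → ℝ)
    (That T : Idx n → ℝ) : Prop :=
  SDPEFeasible Ω That T (Matrix.vecMulVec T T) ∧
  ∀ x X, SDPEFeasible Ω That x X →
    (∑ β : Idx n, w β * Matrix.vecMulVec T T β β) ≤ (∑ β : Idx n, w β * X β β) ∧
    ((∑ β : Idx n, w β * X β β) = (∑ β : Idx n, w β * Matrix.vecMulVec T T β β) →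
      x = T ∧ X = Matrix.vecMulVec T T)

/-- Feasibility for the noisy SDP relaxation (SDP-N). -/
structure SDPNFeasible {d : ℕ} {n : Fin d → ℕ}
    (x : Idx n → ℝ) (X : Matrix (Idx n) (Idx n) ℝ) : Prop where
  isSymm : X.IsSymm
  squares : ∀ α₁ α₂ α₃ α₄ : Idx n, IsSquare α₁ α₂ α₃ α₄ → X α₁ α₂ = X α₃ α₄
  psd : (border x X).PosSemidef

/-- Objective of (SDP-N) with noisy data `Teps` and penalty constant `c`. -/
noncomputable def sdpnObj {d : ℕ} {n : Fin d → ℕ} (Ω : Finset (Idx n))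
    (Teps : Idx n → ℝ) (c : ℝ) (x : Idx n → ℝ) (X : Matrix (Idx n) (Idx n) ℝ) : ℝ :=
  Matrix.trace X + c * ∑ α ∈ Ω, (X α α - 2 * Teps α * x α + Teps α ^ 2)

/-- Optimality for (SDP-N). -/
def SDPNOptimal {d : ℕ} {n : Fin d → ℕ} (Ω : Finset (Idx n)) (Teps : Idx n → ℝ)
    (c : ℝ) (x : Idx n → ℝ) (X : Matrix (Idx n) (Idx n) ℝ) : Prop :=
  SDPNFeasible x X ∧
    ∀ y Y, SDPNFeasible y Y → sdpnObj Ω Teps c x X ≤ sdpnObj Ω Teps c y Y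

/-- Frobenius norm of a square real matrix. -/
noncomputable def frob {m : Type*} [Fintype m] (A : Matrix m m ℝ) : ℝ :=
  Real.sqrt (∑ a : m, ∑ b : m, A a b ^ 2)

/-- `‖ε‖_∞ = max_{α ∈ Ω} |ε α|`. -/
noncomputable def supNormOn {d : ℕ} {n : Fin d → ℕ} (Ω : Finset (Idx n))
    (ε : Idx n → ℝ) : ℝ :=
  ⨆ α : {a : Idx n // a ∈ Ω}, |ε (α : Idx n)|

/-- The function `χ(s) = s + √s`. -/
noncomputable def chiFn (s : ℝ) : ℝ := s + Real.sqrt s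

/-! ### Polynomial (sum of squares) machinery -/

/-- `f_α = x_α - T̂_α`. -/
noncomputable def fPoly {d : ℕ} {n : Fin d → ℕ} (That : Idx n → ℝ) (α : Idx n) :
    MvPolynomial (Idx n) ℝ :=
  MvPolynomial.X α - MvPolynomial.C (That α)

/-- `g_α = x_α² - T̂_α²`. -/
noncomputable def gPoly {d : ℕ} {n : Fin d → ℕ} (That : Idx n → ℝ) (α : Idx n) :
    MvPolynomial (Idx n) ℝ :=
  MvPolynomial.X α ^ 2 - MvPolynomial.C (That α ^ 2)

/-- Sums of squares of polynomials. -/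
def IsSOS {d : ℕ} {n : Fin d → ℕ} (p : MvPolynomial (Idx n) ℝ) : Prop :=
  ∃ (k : ℕ) (q : Fin k → MvPolynomial (Idx n) ℝ), p = ∑ i : Fin k, q i ^ 2

/-- `Σ_{N,2}`: sums of squares of degree at most 2. -/
def SigmaN2 {d : ℕ} {n : Fin d → ℕ} (p : MvPolynomial (Idx n) ℝ) : Prop :=
  IsSOS p ∧ p.totalDegree ≤ 2

/-- The truncated ideal `I₂`, the span of the `f_α` and `g_α` for `α ∈ Ω`. -/
noncomputable def I2span {d : ℕ} {n : Fin d → ℕ} (Ω : Set (Idx n)) (That : Idx n → ℝ) :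
    Submodule ℝ (MvPolynomial (Idx n) ℝ) :=
  Submodule.span ℝ
    ({p | ∃ α ∈ Ω, p = fPoly That α} ∪ {p | ∃ α ∈ Ω, p = gPoly That α})

/-- The truncated ideal `J₂`, the span of the square relations. -/
noncomputable def J2span {d : ℕ} (n : Fin d → ℕ) : Submodule ℝ (MvPolynomial (Idx n) ℝ) :=
  Submodule.span ℝ
    {p | ∃ a b c e : Idx n, IsSquare a b c e ∧
      p = MvPolynomial.X a * MvPolynomial.X b - MvPolynomial.X c * MvPolynomial.X e}

/-- The quadratic polynomial `[1;x]ᵀ Q [1;x]` associated to a matrix `Q ∈ 𝕊^{N+1}`. -/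
noncomputable def gramPoly {d : ℕ} {n : Fin d → ℕ}
    (Q : Matrix (Option (Idx n)) (Option (Idx n)) ℝ) : MvPolynomial (Idx n) ℝ :=
  ∑ a : Option (Idx n), ∑ b : Option (Idx n),
    MvPolynomial.C (Q a b) * (Option.elim a 1 MvPolynomial.X) *
      (Option.elim b 1 MvPolynomial.X)

/-! ### Dual of the noisy SDP -/

/-- The trace inner product `A • B` of two matrices. -/
noncomputable def dotM {m : Type*} [Fintype m] (A B : Matrix m m ℝ) : ℝ :=
  ∑ a : m, ∑ b : m, A a b * B a b

/-- The indicator vector `e_α`, padded with a zero at the extra index. -/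
def indVec {d : ℕ} {n : Fin d → ℕ} (α : Idx n) : Option (Idx n) → ℝ :=
  fun o => if o = some α then 1 else 0

/-- The matrix `A_α = [-T^ε_α; e_α][-T^ε_α; e_α]ᵀ`. -/
noncomputable def Amat {d : ℕ} {n : Fin d → ℕ} (Teps : Idx n → ℝ) (α : Idx n) :
    Matrix (Option (Idx n)) (Option (Idx n)) ℝ :=
  Matrix.vecMulVec (fun o => Option.elim o (-Teps α) (fun β => if β = α then 1 else 0))
    (fun o => Option.elim o (-Teps α) (fun β => if β = α then 1 else 0))

/-- The (padded) matrix `E_{α,β} = e_α e_βᵀ + e_β e_αᵀ`. -/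
noncomputable def Ebig {d : ℕ} {n : Fin d → ℕ} (a b : Idx n) :
    Matrix (Option (Idx n)) (Option (Idx n)) ℝ :=
  Matrix.vecMulVec (indVec a) (indVec b) + Matrix.vecMulVec (indVec b) (indVec a)

/-- The matrix `[[1,0],[0,0]]`. -/
def E00 {d : ℕ} {n : Fin d → ℕ} : Matrix (Option (Idx n)) (Option (Idx n)) ℝ :=
  Matrix.of fun a b => if a = none ∧ b = none then 1 else 0

/-- The matrix `[[0,0],[0,I_N]]`. -/
def Ibot {d : ℕ} {n : Fin d → ℕ} : Matrix (Option (Idx n)) (Option (Idx n)) ℝ :=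
  1 - E00

open Classical in
/-- The dual slack matrix of (dSDP-N) associated to data `(ρ, μ)`. -/
noncomputable def dualNMatrix {d : ℕ} {n : Fin d → ℕ} (Ω : Finset (Idx n))
    (Teps : Idx n → ℝ) (c ρ : ℝ) (μ : Idx n → Idx n → Idx n → Idx n → ℝ) :
    Matrix (Option (Idx n)) (Option (Idx n)) ℝ :=
  Ibot - ρ • E00 + c • (∑ α ∈ Ω, Amat Teps α) -
    ∑ a : Idx n, ∑ b : Idx n, ∑ cc : Idx n, ∑ e : Idx n,
      (if IsSquare a b cc e then (μ a b cc e / 2) • (Ebig a b - Ebig cc e) else 0)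

/-- Dual feasibility for (dSDP-N): `Q` is PSD and has the prescribed dual form. -/
def DualNFeasible {d : ℕ} {n : Fin d → ℕ} (Ω : Finset (Idx n)) (Teps : Idx n → ℝ)
    (c : ℝ) (Q : Matrix (Option (Idx n)) (Option (Idx n)) ℝ) : Prop :=
  Q.PosSemidef ∧ ∃ (ρ : ℝ) (μ : Idx n → Idx n → Idx n → Idx n → ℝ),
    Q = dualNMatrix Ω Teps c ρ μ

/-! ### Level-based weights (Algorithm 1) -/

/-- Cumulative level sets: level 0 is `𝒫_SR(Ω)`; each next level adds the tuples
completing a square with three previously reached tuples. -/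
def srLevelSet {d : ℕ} {n : Fin d → ℕ} (Ω : Set (Idx n)) : ℕ → Set (Idx n)
  | 0 => {β | PSR Ω β}
  | (ℓ + 1) => srLevelSet Ω ℓ ∪ {β | ∃ a b c : Idx n,
      a ∈ srLevelSet Ω ℓ ∧ b ∈ srLevelSet Ω ℓ ∧ c ∈ srLevelSet Ω ℓ ∧ IsSquare a b c β}

/-- The level-based weight vector `w(ϑ)`: `w(ϑ)_β = ϑ^ℓ` where `ℓ` is the first level
containing `β`. -/
noncomputable def levelWeight {d : ℕ} {n : Fin d → ℕ} (Ω : Set (Idx n)) (θ : ℝ)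
    (β : Idx n) : ℝ :=
  θ ^ sInf {ℓ : ℕ | β ∈ srLevelSet Ω ℓ}

/-! ### Random masks -/

/-- The Bernoulli measure on `Bool` with success probability `p`. -/
noncomputable def bern (p : ℝ) : Measure Bool :=
  (ENNReal.ofReal p) • Measure.dirac true + (ENNReal.ofReal (1 - p)) • Measure.dirac false


/-! ### Rank-one tensors on squares and levels -/

theorem IsRankOne.mul_eq_mul_of_isSquare {d : ℕ} {n : Fin d → ℕ} {T : Idx n → ℝ}
    (hT : IsRankOne T) {a b c e : Idx n} (h : IsSquare a b c e) : T a * T b = T c * T e := by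
  obtain ⟨u, hu⟩ := hT
  rw [hu, hu, hu, hu, ← Finset.prod_mul_distrib, ← Finset.prod_mul_distrib]
  refine Finset.prod_congr rfl fun k _ => ?_
  obtain ⟨h₁, h₂⟩ := h.2 k
  have key : (a k = c k ∧ b k = e k) ∨ (a k = e k ∧ b k = c k) := by
    rcases le_total (a k) (b k) with h₃ | h₃ <;> rcases le_total (c k) (e k) with h₄ | h₄ <;>
      simp_all
  rcases key with ⟨h₃, h₄⟩ | ⟨h₃, h₄⟩ <;> rw [h₃, h₄]
  ring

theorem PS.ne_zero {d : ℕ} {n : Fin d → ℕ} {Ω : Set (Idx n)} {T : Idx n → ℝ}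
    (hT : IsRankOne T) (hΩ : ∀ α ∈ Ω, T α ≠ 0) {β : Idx n} (h : PS Ω β) : T β ≠ 0 := by
  induction h with
  | base h => exact hΩ _ h
  | prop hsq _ _ _ h₁ h₂ _ =>
    exact right_ne_zero_of_mul (hT.mul_eq_mul_of_isSquare hsq ▸ mul_ne_zero h₁ h₂)

theorem srLevelSet_mono {d : ℕ} {n : Fin d → ℕ} (Ω : Set (Idx n)) : Monotone (srLevelSet Ω) :=
  monotone_nat_of_le_succ fun _ => Set.subset_union_left

theorem PS.exists_mem_srLevelSet {d : ℕ} {n : Fin d → ℕ} {Ω : Set (Idx n)} {β : Idx n}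
    (h : PS Ω β) : ∃ ℓ, β ∈ srLevelSet Ω ℓ := by
  induction h with
  | base h => exact ⟨0, PSR.base h⟩
  | prop hsq _ _ _ h₁ h₂ h₃ =>
    obtain ⟨i, hi⟩ := h₁
    obtain ⟨j, hj⟩ := h₂
    obtain ⟨k, hk⟩ := h₃
    exact ⟨max i (max j k) + 1, Or.inr ⟨_, _, _,
      srLevelSet_mono Ω (le_max_left _ _) hi,
      srLevelSet_mono Ω ((le_max_left _ _).trans (le_max_right _ _)) hj,
      srLevelSet_mono Ω ((le_max_right _ _).trans (le_max_right _ _)) hk, hsq⟩⟩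

/-- The first level containing `β`. -/
noncomputable def srLevel {d : ℕ} {n : Fin d → ℕ} (Ω : Set (Idx n)) (β : Idx n) : ℕ :=
  sInf {ℓ : ℕ | β ∈ srLevelSet Ω ℓ}

theorem SPropagation.mem_srLevelSet_srLevel {d : ℕ} {n : Fin d → ℕ} {Ω : Set (Idx n)}
    (hS : SPropagation Ω) (β : Idx n) : β ∈ srLevelSet Ω (srLevel Ω β) :=
  Nat.sInf_mem (s := {ℓ : ℕ | β ∈ srLevelSet Ω ℓ}) (hS β).exists_mem_srLevelSet

theorem srLevel_le {d : ℕ} {n : Fin d → ℕ} {Ω : Set (Idx n)} {β : Idx n} {ℓ : ℕ}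
    (h : β ∈ srLevelSet Ω ℓ) : srLevel Ω β ≤ ℓ :=
  Nat.sInf_le h

theorem SPropagation.psr_or_exists_isSquare {d : ℕ} {n : Fin d → ℕ} {Ω : Set (Idx n)}
    (hS : SPropagation Ω) (β : Idx n) :
    PSR Ω β ∨ ∃ a b c : Idx n, srLevel Ω a < srLevel Ω β ∧ srLevel Ω b < srLevel Ω β ∧
      srLevel Ω c < srLevel Ω β ∧ IsSquare a b c β := by
  have hmem := hS.mem_srLevelSet_srLevel β
  rcases hℓ : srLevel Ω β with _ | ℓ
  · rw [hℓ] at hmem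
    exact Or.inl hmem
  · rw [hℓ] at hmem
    rcases hmem with hmem | ⟨a, b, c, ha, hb, hc, hsq⟩
    · have := srLevel_le hmem
      omega
    · exact Or.inr ⟨a, b, c, Nat.lt_succ_of_le (srLevel_le ha),
        Nat.lt_succ_of_le (srLevel_le hb), Nat.lt_succ_of_le (srLevel_le hc), hsq⟩

/-! ### Geometric estimates along levels -/

theorem two_mul_abs_dotProduct_le {κ : Type*} [Fintype κ] (v w : κ → ℝ) {r : ℝ} (hr : 0 < r) :
    2 * |v ⬝ᵥ w| ≤ r * (v ⬝ᵥ v) + r⁻¹ * (w ⬝ᵥ w) := by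
  have hsq : ∀ s : ℝ, 0 ≤ r * (v ⬝ᵥ v) + 2 * s * (v ⬝ᵥ w) + r⁻¹ * s ^ 2 * (w ⬝ᵥ w) := by
    intro s
    have h : r * (v ⬝ᵥ v) + 2 * s * (v ⬝ᵥ w) + r⁻¹ * s ^ 2 * (w ⬝ᵥ w) =
        ∑ k, r⁻¹ * (r * v k + s * w k) ^ 2 := by
      simp only [dotProduct, Finset.mul_sum, ← Finset.sum_add_distrib]
      refine Finset.sum_congr rfl fun k _ => ?_
      field_simp
      ring
    rw [h]
    positivity
  have h₁ := hsq 1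
  have h₂ := hsq (-1)
  rcases abs_cases (v ⬝ᵥ w) with ⟨h, _⟩ | ⟨h, _⟩ <;> rw [h] <;> linarith

theorem dotProduct_self_nonneg {κ : Type*} [Fintype κ] (v : κ → ℝ) : 0 ≤ v ⬝ᵥ v :=
  Finset.sum_nonneg fun k _ => mul_self_nonneg (v k)

/-- The total squared length of the vectors `z γ` with level below `ℓ`. -/
noncomputable def energyBelow {ι κ : Type*} [Fintype ι] [Fintype κ] (lev : ι → ℕ)
    (z : ι → κ → ℝ) (ℓ : ℕ) : ℝ :=
  ∑ γ with lev γ < ℓ, z γ ⬝ᵥ z γ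

section Energy

variable {ι κ : Type*} [Fintype ι] [Fintype κ]

theorem energyBelow_nonneg (lev : ι → ℕ) (z : ι → κ → ℝ) (ℓ : ℕ) : 0 ≤ energyBelow lev z ℓ :=
  Finset.sum_nonneg fun γ _ => dotProduct_self_nonneg (z γ)

theorem energyBelow_mono (lev : ι → ℕ) (z : ι → κ → ℝ) : Monotone (energyBelow lev z) := by
  intro i j hij
  refine Finset.sum_le_sum_of_subset_of_nonneg (fun γ => ?_)
    fun γ _ _ => dotProduct_self_nonneg (z γ)
  simp only [Finset.mem_filter, Finset.mem_univ, true_and]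
  omega

theorem dotProduct_self_le_energyBelow {lev : ι → ℕ} (z : ι → κ → ℝ) {ℓ : ℕ} {a : ι}
    (ha : lev a < ℓ) : z a ⬝ᵥ z a ≤ energyBelow lev z ℓ :=
  Finset.single_le_sum (f := fun γ => z γ ⬝ᵥ z γ) (fun γ _ => dotProduct_self_nonneg (z γ))
    (by simpa using ha)

/-- A scalar `e β` that vanishes, or satisfies the linearized square relation in terms of
elements of smaller level, is controlled by the squared lengths of the `z γ`. -/
theorem exists_abs_le_add_energyBelow (lev : ι → ℕ) :
    ∃ C : ℝ, 0 ≤ C ∧ ∀ (z : ι → κ → ℝ) (e : ι → ℝ),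
      (∀ β, e β = 0 ∨ ∃ a b c, lev a < lev β ∧ lev b < lev β ∧ lev c < lev β ∧
        e a + e b + z a ⬝ᵥ z b = e c + e β + z c ⬝ᵥ z β) →
      ∀ β, |e β| ≤ 1 / 4 * (z β ⬝ᵥ z β) + C * energyBelow lev z (lev β) := by
  have main : ∀ m : ℕ, ∃ C : ℝ, 0 ≤ C ∧ ∀ (z : ι → κ → ℝ) (e : ι → ℝ),
      (∀ β, e β = 0 ∨ ∃ a b c, lev a < lev β ∧ lev b < lev β ∧ lev c < lev β ∧
        e a + e b + z a ⬝ᵥ z b = e c + e β + z c ⬝ᵥ z β) →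
      ∀ β, lev β < m → |e β| ≤ 1 / 4 * (z β ⬝ᵥ z β) + C * energyBelow lev z (lev β) := by
    intro m
    induction m with
    | zero => exact ⟨0, le_rfl, fun _ _ _ _ h => absurd h (Nat.not_lt_zero _)⟩
    | succ m ih =>
      obtain ⟨C, hC, h⟩ := ih
      refine ⟨3 * (1 / 4 + C) + 2, by positivity, fun z e he β hβ => ?_⟩
      have hS := energyBelow_nonneg lev z (lev β)
      have hq := dotProduct_self_nonneg (z β)
      rcases he β with h0 | ⟨a, b, c, ha, hb, hc, hrel⟩
      · rw [h0, abs_zero]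
        positivity
      · have bound : ∀ γ, lev γ < lev β → |e γ| ≤ (1 / 4 + C) * energyBelow lev z (lev β) := by
          intro γ hγ
          have h₁ := h z e he γ (by omega)
          have h₂ := dotProduct_self_le_energyBelow z hγ
          have h₃ := mul_le_mul_of_nonneg_left (energyBelow_mono lev z hγ.le) hC
          linarith
        have ea := bound a ha
        have eb := bound b hb
        have ec := bound c hc
        have qa := dotProduct_self_le_energyBelow z ha
        have qb := dotProduct_self_le_energyBelow z hb
        have qc := dotProduct_self_le_energyBelow z hc
        have hab := two_mul_abs_dotProduct_le (z a) (z b) one_pos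
        have hcβ := two_mul_abs_dotProduct_le (z c) (z β) (r := 2) two_pos
        rw [abs_le] at ea eb ec
        have hab₁ := neg_abs_le (z a ⬝ᵥ z b)
        have hab₂ := le_abs_self (z a ⬝ᵥ z b)
        have hcβ₁ := neg_abs_le (z c ⬝ᵥ z β)
        have hcβ₂ := le_abs_self (z c ⬝ᵥ z β)
        rw [abs_le]
        constructor <;> linarith
  obtain ⟨C, hC, h⟩ := main (Finset.univ.sup lev + 1)
  exact ⟨C, hC, fun z e he β =>
    h z e he β (Nat.lt_succ_of_le (Finset.le_sup (Finset.mem_univ β)))⟩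

theorem sum_pow_mul_energyBelow_le (lev : ι → ℕ) (z : ι → κ → ℝ) {τ : ι → ℝ}
    (hτ : ∀ β, 0 ≤ τ β) {θ : ℝ} (h0 : 0 ≤ θ) (h1 : θ ≤ 1) :
    ∑ β, θ ^ lev β * τ β * energyBelow lev z (lev β) ≤
      ∑ γ, θ ^ lev γ * (θ * ∑ β, τ β) * (z γ ⬝ᵥ z γ) := by
  simp only [energyBelow, Finset.sum_filter, Finset.mul_sum, Finset.sum_mul]
  rw [Finset.sum_comm]
  refine Finset.sum_le_sum fun γ _ => Finset.sum_le_sum fun β _ => ?_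
  have hq := dotProduct_self_nonneg (z γ)
  have hβ := hτ β
  split_ifs with hlt
  · calc θ ^ lev β * τ β * (z γ ⬝ᵥ z γ) ≤ θ ^ (lev γ + 1) * τ β * (z γ ⬝ᵥ z γ) := by
          gcongr ?_ * _ * _
          exact pow_le_pow_of_le_one h0 h1 hlt
      _ = θ ^ lev γ * (θ * τ β) * (z γ ⬝ᵥ z γ) := by ring
  · rw [mul_zero]
    positivity

theorem exists_threshold_weighted_sum (lev : ι → ℕ) {τ : ι → ℝ} (hτ : ∀ β, 0 < τ β) :
    ∃ t ∈ Set.Ioo (0 : ℝ) 1, ∀ θ ∈ Set.Ioo (0 : ℝ) t, ∀ (z : ι → κ → ℝ) (e : ι → ℝ),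
      (∀ β, e β = 0 ∨ ∃ a b c, lev a < lev β ∧ lev b < lev β ∧ lev c < lev β ∧
        e a + e b + z a ⬝ᵥ z b = e c + e β + z c ⬝ᵥ z β) →
      0 ≤ ∑ β, θ ^ lev β * τ β * (2 * e β + z β ⬝ᵥ z β) ∧
      (∑ β, θ ^ lev β * τ β * (2 * e β + z β ⬝ᵥ z β) = 0 → ∀ β, e β = 0 ∧ z β = 0) := by
  obtain ⟨C, hC, hbound⟩ := exists_abs_le_add_energyBelow (κ := κ) lev
  obtain ⟨m, hm, hmτ⟩ : ∃ m : ℝ, 0 < m ∧ ∀ β, m ≤ τ β := by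
    rcases isEmpty_or_nonempty ι with _ | _
    · exact ⟨1, one_pos, isEmptyElim⟩
    · obtain ⟨β, hβ⟩ := Finite.exists_min τ
      exact ⟨τ β, hτ β, hβ⟩
  have hK : 0 ≤ ∑ β, τ β := Finset.sum_nonneg fun β _ => (hτ β).le
  have hD : 0 < 8 * C * (∑ β, τ β) + 1 := by positivity
  refine ⟨min (1 / 2) (m / (8 * C * (∑ β, τ β) + 1)), ⟨by positivity,
    (min_le_left _ _).trans_lt (by norm_num)⟩, fun θ hθ z e he => ?_⟩
  have hθ0 : 0 < θ := hθ.1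
  have hθ1 : θ ≤ 1 := (hθ.2.trans_le (min_le_left _ _)).le.trans (by norm_num)
  have hθm : θ * (8 * C * (∑ β, τ β) + 1) < m :=
    (lt_div_iff₀ hD).1 (hθ.2.trans_le (min_le_right _ _))
  have hb := hbound z e he
  have lower : ∑ β, θ ^ lev β * (m / 4) * (z β ⬝ᵥ z β) ≤
      ∑ β, θ ^ lev β * τ β * (2 * e β + z β ⬝ᵥ z β) := by
    have h₁ : ∑ β, θ ^ lev β * τ β * (1 / 2 * (z β ⬝ᵥ z β)
          - 2 * C * energyBelow lev z (lev β)) ≤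
        ∑ β, θ ^ lev β * τ β * (2 * e β + z β ⬝ᵥ z β) := by
      refine Finset.sum_le_sum fun β _ => ?_
      have h₂ := hb β
      have h₃ := neg_abs_le (e β)
      have h₄ := hτ β
      gcongr
      linarith
    have h₅ := mul_le_mul_of_nonneg_left
      (sum_pow_mul_energyBelow_le lev z (fun β => (hτ β).le) hθ0.le hθ1)
      (show 0 ≤ 2 * C by positivity)
    have h₆ : ∑ β, θ ^ lev β * (m / 4) * (z β ⬝ᵥ z β) ≤
        ∑ β, (θ ^ lev β * τ β * (1 / 2 * (z β ⬝ᵥ z β)) -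
          2 * C * (θ ^ lev β * (θ * ∑ γ, τ γ) * (z β ⬝ᵥ z β))) := by
      refine Finset.sum_le_sum fun β _ => ?_
      have h₇ : m / 4 ≤ τ β / 2 - 2 * C * (θ * ∑ γ, τ γ) := by
        have := hmτ β
        nlinarith
      have h₈ := mul_le_mul_of_nonneg_left h₇
        (mul_nonneg (pow_nonneg hθ0.le (lev β)) (dotProduct_self_nonneg (z β)))
      linarith
    rw [Finset.sum_sub_distrib, ← Finset.mul_sum] at h₆
    have h₉ : ∑ β, θ ^ lev β * τ β * (1 / 2 * (z β ⬝ᵥ z β)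
          - 2 * C * energyBelow lev z (lev β)) =
        ∑ β, θ ^ lev β * τ β * (1 / 2 * (z β ⬝ᵥ z β)) -
          2 * C * ∑ β, θ ^ lev β * τ β * energyBelow lev z (lev β) := by
      rw [Finset.mul_sum, ← Finset.sum_sub_distrib]
      exact Finset.sum_congr rfl fun β _ => by ring
    linarith
  have term_nonneg : ∀ β ∈ Finset.univ, 0 ≤ θ ^ lev β * (m / 4) * (z β ⬝ᵥ z β) := fun β _ =>
    mul_nonneg (by positivity) (dotProduct_self_nonneg (z β))
  refine ⟨(Finset.sum_nonneg term_nonneg).trans lower, fun hzero => ?_⟩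
  have hall := (Finset.sum_eq_zero_iff_of_nonneg term_nonneg).1
    (le_antisymm (lower.trans hzero.le) (Finset.sum_nonneg term_nonneg))
  have hz : ∀ β, z β = 0 := fun β => by
    have h := (mul_eq_zero.1 (hall β (Finset.mem_univ β))).resolve_left (by positivity)
    exact dotProduct_self_eq_zero.1 h
  refine fun β => ⟨?_, hz β⟩
  simpa [energyBelow, hz] using hb β

end Energy

/-! ### Feasible points of the relaxation -/

theorem IsRankOne.sdpeFeasible {d : ℕ} {n : Fin d → ℕ} {Ω : Set (Idx n)} {That T : Idx n → ℝ}
    (hT : IsRankOne T) (hTm : ∀ α ∈ Ω, T α = That α) :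
    SDPEFeasible Ω That T (Matrix.vecMulVec T T) where
  isSymm := by
    ext a b
    simp [Matrix.vecMulVec_apply, mul_comm]
  obs := hTm
  obsDiag α hα := by rw [Matrix.vecMulVec_apply, hTm α hα, sq]
  squares _ _ _ _ h := hT.mul_eq_mul_of_isSquare h
  psd := by
    have h : border T (Matrix.vecMulVec T T) =
        Matrix.vecMulVec (fun o : Option (Idx n) => o.elim 1 T)
          (star fun o : Option (Idx n) => o.elim 1 T) := by
      ext (_ | a) (_ | b) <;> simp [border, Matrix.vecMulVec_apply]
    rw [h]
    exact Matrix.posSemidef_vecMulVec_self_star _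

open scoped MatrixOrder Matrix.Norms.L2Operator in
theorem _root_.Matrix.PosSemidef.exists_eq_conjTranspose_mul_self {m : Type*} [Fintype m]
    {M : Matrix m m ℝ} (hM : M.PosSemidef) : ∃ B : Matrix m m ℝ, M = B.conjTranspose * B := by
  classical
  exact CStarAlgebra.nonneg_iff_eq_star_mul_self.1 hM.nonneg

/-- In a Gram factorization of a feasible point normalized by a nowhere vanishing rank-one
tensor, `z α` is the difference of the vector of `α` and the vector of the border, and `e α` is
the component of `z α` along the latter. -/
theorem SDPEFeasible.exists_gram {d : ℕ} {n : Fin d → ℕ} {Ω : Set (Idx n)} {That T : Idx n → ℝ}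
    (hT : IsRankOne T) (hT0 : ∀ α, T α ≠ 0) (hTm : ∀ α ∈ Ω, T α = That α)
    {x : Idx n → ℝ} {X : Matrix (Idx n) (Idx n) ℝ} (h : SDPEFeasible Ω That x X) :
    ∃ (z : Idx n → Option (Idx n) → ℝ) (e : Idx n → ℝ),
      (∀ α, x α = T α * (1 + e α)) ∧
      (∀ α β, X α β = T α * T β * (1 + e α + e β + z α ⬝ᵥ z β)) ∧
      (∀ a b c β, IsSquare a b c β → e a + e b + z a ⬝ᵥ z b = e c + e β + z c ⬝ᵥ z β) ∧
      ∀ β, PSR Ω β → e β = 0 := by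
  obtain ⟨B, hB⟩ := h.psd.exists_eq_conjTranspose_mul_self
  have entry : ∀ i j, border x X i j = ∑ k, B k i * B k j := fun i j => by
    rw [hB]
    simp [Matrix.mul_apply]
  have h00 : (1 : ℝ) = ∑ k, B k none * B k none := entry none none
  have h0 : ∀ α, x α = ∑ k, B k none * B k (some α) := fun α => entry none (some α)
  have hX : ∀ α β, X α β = ∑ k, B k (some α) * B k (some β) := fun α β =>
    entry (some α) (some β)
  let z : Idx n → Option (Idx n) → ℝ := fun α k => (T α)⁻¹ * B k (some α) - B k none
  let e : Idx n → ℝ := fun α => (T α)⁻¹ * x α - 1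
  have hx : ∀ α, x α = T α * (1 + e α) := fun α => by
    have := hT0 α
    simp only [e]
    field_simp
    ring
  have hz : ∀ α β, z α ⬝ᵥ z β = (T α)⁻¹ * (T β)⁻¹ * X α β - (T α)⁻¹ * x α - (T β)⁻¹ * x β + 1 := by
    intro α β
    rw [h00, h0, h0, hX]
    simp only [z, dotProduct, Finset.mul_sum, ← Finset.sum_sub_distrib, ← Finset.sum_add_distrib]
    exact Finset.sum_congr rfl fun k _ => by ring
  have hXz : ∀ α β, X α β = T α * T β * (1 + e α + e β + z α ⬝ᵥ z β) := fun α β => by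
    have := hT0 α
    have := hT0 β
    rw [hz]
    simp only [e]
    field_simp
    ring
  have hsquare : ∀ a b c β, IsSquare a b c β →
      e a + e b + z a ⬝ᵥ z b = e c + e β + z c ⬝ᵥ z β := fun a b c β hsq => by
    have h₁ := h.squares a b c β hsq
    rw [hXz, hXz, ← hT.mul_eq_mul_of_isSquare hsq] at h₁
    have h₂ := mul_left_cancel₀ (mul_ne_zero (hT0 a) (hT0 b)) h₁
    linarith
  have he_obs : ∀ α ∈ Ω, e α = 0 := fun α hα => by
    simp only [e]
    rw [h.obs α hα, ← hTm α hα, inv_mul_cancel₀ (hT0 α), sub_self]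
  have hz_obs : ∀ α ∈ Ω, z α = 0 := fun α hα => by
    have h₁ := hXz α α
    rw [h.obsDiag α hα, ← hTm α hα, he_obs α hα, sq] at h₁
    have h₂ := mul_left_cancel₀ (mul_ne_zero (hT0 α) (hT0 α)) ((mul_one _).trans h₁)
    exact dotProduct_self_eq_zero.1 (by linarith)
  refine ⟨z, e, hx, hXz, hsquare, fun β hβ => ?_⟩
  induction hβ with
  | base hα => exact he_obs _ hα
  | prop hsq h₁ h₂ _ ih =>
    have h₃ := hsquare _ _ _ _ hsq
    rw [he_obs _ h₁, he_obs _ h₂, hz_obs _ h₁, hz_obs _ h₂, ih] at h₃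
    simpa using h₃.symm

/-- Under S-propagation and nonzero observations, there exists
`t ∈ (0,1)` such that for every `ϑ ∈ (0,t)` the weighted relaxation (SDP-Eʷ) with the
level-based weights `w(ϑ)` (Algorithm 1) is tight. -/
theorem statement11 {d : ℕ} {n : Fin d → ℕ} (Ω : Set (Idx n)) (That : Idx n → ℝ)
    (hS : SPropagation Ω) (hnz : ∀ α ∈ Ω, That α ≠ 0)
    (T : Idx n → ℝ) (hT : IsRankOne T) (hTm : ∀ α ∈ Ω, T α = That α) :
    ∃ t : ℝ, t ∈ Set.Ioo (0 : ℝ) 1 ∧ ∀ θ ∈ Set.Ioo (0 : ℝ) t,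
      SDPEwTight Ω (levelWeight Ω θ) That T := by
  have hT0 : ∀ α, T α ≠ 0 := fun α =>
    (hS α).ne_zero hT fun γ hγ => hTm γ hγ ▸ hnz γ hγ
  obtain ⟨t, ht, hmain⟩ := exists_threshold_weighted_sum (κ := Option (Idx n)) (srLevel Ω)
    (τ := fun β => T β * T β) fun β => mul_self_pos.2 (hT0 β)
  refine ⟨t, ht, fun θ hθ => ⟨hT.sdpeFeasible hTm, fun x X hX => ?_⟩⟩
  obtain ⟨z, e, hx, hXz, hsquare, hpsr⟩ := hX.exists_gram hT hT0 hTm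
  obtain ⟨hnonneg, hzero⟩ := hmain θ hθ z e fun β =>
    (hS.psr_or_exists_isSquare β).imp (hpsr β) fun ⟨a, b, c, ha, hb, hc, hsq⟩ =>
      ⟨a, b, c, ha, hb, hc, hsquare a b c β hsq⟩
  have hdiff : ∑ β, θ ^ srLevel Ω β * (T β * T β) * (2 * e β + z β ⬝ᵥ z β) =
      ∑ β, levelWeight Ω θ β * X β β -
        ∑ β, levelWeight Ω θ β * Matrix.vecMulVec T T β β := by
    rw [← Finset.sum_sub_distrib]
    refine Finset.sum_congr rfl fun β _ => ?_
    rw [hXz β β, Matrix.vecMulVec_apply, levelWeight, srLevel]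
    ring
  rw [hdiff] at hnonneg hzero
  refine ⟨sub_nonneg.1 hnonneg, fun heq => ?_⟩
  have hall := hzero (sub_eq_zero.2 heq)
  refine ⟨funext fun α => ?_, ?_⟩
  · rw [hx, (hall α).1, add_zero, mul_one]
  · ext α β
    rw [hXz, (hall α).1, (hall β).1, (hall α).2, Matrix.vecMulVec_apply]
    simp

end RankOneTC
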